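/- arXiv:1207.0451 — 2 statements merged into one kernel-verified Lean document; each statement's English description precedes it below -/
import Mathlib

section
/- Let G be a group with a finite symmetric generating set S, let 1 < p < ∞, and let f : G → ℝ be p-Dirichlet. Suppose there is a sequence (ξ_n) of finitely supported functions ξ_n : G → ℝ such that: (1) Σ_{γ∈G} ξ_n(γ) = 1 for every n; (2) for every s ∈ S and every x ∈ G, ∇_s(ξ_n * f)(x) → 0 as n → ∞; (3) there is K > 0 with ‖∇_s(ξ_n * f)‖_{ℓ^p(G)} ≤ K for all n and all s ∈ S. Then the reduced cohomology class of f is trivial: for every ε > 0 there exists h ∈ ℓ^p(G) with ‖∇_s(f − h)‖_{ℓ^p(G)} < ε for every s ∈ S. -/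
open Filter Topology

/-- Word length of `g` with respect to the generating set `S`. -/
noncomputable def wordLength {G : Type*} [Group G] (S : Finset G) (g : G) : ℕ :=
  sInf {n : ℕ | ∃ l : List G, l.length = n ∧ (∀ x ∈ l, x ∈ S) ∧ l.prod = g}

/-- Cayley graph distance `d(x,y) = |y * x⁻¹|`. -/
noncomputable def cayleyDist {G : Type*} [Group G] (S : Finset G) (x y : G) : ℝ :=
  (wordLength S (y * x⁻¹) : ℝ)

/-- Partial gradient `∇ₛ f (x) = f (s⁻¹ x) - f x`. -/
def grad {G : Type*} [Group G] (s : G) (f : G → ℝ) : G → ℝ :=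
  fun x => f (s⁻¹ * x) - f x

/-- `f` is `p`-summable. -/
def MemLp' {G : Type*} (p : ℝ) (f : G → ℝ) : Prop :=
  Summable fun x => |f x| ^ p

/-- The `ℓ^p` norm of `f`. -/
noncomputable def lpNorm {G : Type*} (p : ℝ) (f : G → ℝ) : ℝ :=
  (∑' x, |f x| ^ p) ^ (1 / p)

/-- `f` is `p`-Dirichlet: every partial gradient is in `ℓ^p`. -/
def IsDirichlet {G : Type*} [Group G] (S : Finset G) (p : ℝ) (f : G → ℝ) : Prop :=
  ∀ s ∈ S, MemLp' p (grad s f)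

/-- Convolution `(ξ * f)(x) = ∑ ξ γ • f (γ⁻¹ x)`. -/
noncomputable def conv {G : Type*} [Group G] (ξ f : G → ℝ) : G → ℝ :=
  fun x => ∑' γ, ξ γ * f (γ⁻¹ * x)

/-- A finitely supported probability measure on `G`. -/
def IsProbMeasure {G : Type*} (ξ : G → ℝ) : Prop :=
  (∀ x, 0 ≤ ξ x) ∧ (Function.support ξ).Finite ∧ (∑' x, ξ x) = 1

/-- `ξ^∨ (x) = ξ (x⁻¹)`. -/
def invMeasure {G : Type*} [Group G] (ξ : G → ℝ) : G → ℝ := fun x => ξ x⁻¹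

/-- `(ρ_s ξ^∨)(x) = ξ^∨ (x * s)`. -/
def rhoInvMeasure {G : Type*} [Group G] (ξ : G → ℝ) (s : G) : G → ℝ :=
  fun x => ξ (x * s)⁻¹

/-- `m` is a coupling of `ξ` and `φ`. -/
def IsCoupling {G : Type*} (m : G × G → ℝ) (ξ φ : G → ℝ) : Prop :=
  (∀ z, 0 ≤ m z) ∧ (Function.support m).Finite ∧
    (∀ x, (∑' y, m (x, y)) = ξ x) ∧ (∀ y, (∑' x, m (x, y)) = φ y)

/-- The transportation cost between `ξ` and `φ`, for the Cayley distance of `(G,S)`. -/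
noncomputable def Trc {G : Type*} [Group G] (S : Finset G) (ξ φ : G → ℝ) : ℝ :=
  sInf {c : ℝ | ∃ m, IsCoupling m ξ φ ∧ c = ∑' z : G × G, m z * cayleyDist S z.1 z.2}

/-- `G` is transport amenable (with respect to `S`). -/
def TransportAmenable {G : Type*} [Group G] (S : Finset G) : Prop :=
  ∃ K > (0 : ℝ), ∃ ξ : ℕ → G → ℝ,
    (∀ n, IsProbMeasure (ξ n)) ∧
    (∀ γ : G, Tendsto (fun n => ∑' x, |ξ n (γ⁻¹ * x) - ξ n x|) atTop (𝓝 0)) ∧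
    (∀ s ∈ S, ∀ n, Trc S (rhoInvMeasure (ξ n) s) (invMeasure (ξ n)) ≤ K)

section Summability

variable {ι : Type*} {p : ℝ}

theorem abs_add_rpow_le (hp : 1 ≤ p) (a b : ℝ) :
    |a + b| ^ p ≤ 2 ^ (p - 1) * (|a| ^ p + |b| ^ p) := by
  have h := NNReal.rpow_add_le_mul_rpow_add_rpow (Real.nnabs a) (Real.nnabs b) hp
  have h' : (|a| + |b|) ^ p ≤ 2 ^ (p - 1) * (|a| ^ p + |b| ^ p) := by exact_mod_cast h
  exact (Real.rpow_le_rpow (abs_nonneg _) (abs_add_le a b) (by linarith)).trans h'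

theorem MemLp'.add (hp : 1 ≤ p) {u v : ι → ℝ} (hu : MemLp' p u) (hv : MemLp' p v) :
    MemLp' p (fun i => u i + v i) :=
  Summable.of_nonneg_of_le (fun _ => by positivity) (fun i => abs_add_rpow_le hp (u i) (v i))
    ((Summable.add hu hv).mul_left _)

theorem MemLp'.const_mul {u : ι → ℝ} (hu : MemLp' p u) (c : ℝ) :
    MemLp' p (fun i => c * u i) := by
  unfold MemLp'
  simp only [abs_mul, Real.mul_rpow (abs_nonneg _) (abs_nonneg _)]
  exact Summable.mul_left _ hu

theorem memLp'_zero (hp : 1 ≤ p) : MemLp' p (fun _ : ι => (0 : ℝ)) := by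
  unfold MemLp'
  simp [Real.zero_rpow (by linarith : p ≠ 0)]

theorem MemLp'.sum (hp : 1 ≤ p) {κ : Type*} (t : Finset κ) {u : κ → ι → ℝ}
    (hu : ∀ k ∈ t, MemLp' p (u k)) : MemLp' p (fun i => ∑ k ∈ t, u k i) := by
  classical
  induction t using Finset.induction_on with
  | empty => simpa using memLp'_zero hp
  | insert k t hk ih =>
    simp only [Finset.sum_insert hk]
    exact (hu k (by simp)).add hp (ih fun j hj => hu j (by simp [hj]))

theorem MemLp'.comp_injective {κ : Type*} {u : ι → ℝ} (hu : MemLp' p u) {e : κ → ι}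
    (he : Function.Injective e) : MemLp' p (fun k => u (e k)) :=
  Summable.comp_injective hu he

/-- Adding a far term of a bounded, pointwise null sequence to an `ℓ^p` function increases the
`p`-th power of the norm by at most a constant independent of that function. -/
theorem eventually_tsum_abs_add_rpow_le (hp : 1 ≤ p) {u : ι → ℝ} (hu : MemLp' p u)
    {v : ℕ → ι → ℝ} (hv : ∀ n, MemLp' p (v n)) {C : ℝ} (hC : ∀ n, ∑' i, |v n i| ^ p ≤ C)
    (hlim : ∀ i, Tendsto (fun n => v n i) atTop (𝓝 0)) :
    ∀ᶠ n in atTop, ∑' i, |u i + v n i| ^ p ≤ ∑' i, |u i| ^ p + (2 ^ (p - 1) * C + 1) := by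
  have hp0 : 0 < p := by linarith
  set g : ℕ → ι → ℝ := fun n i => max (|u i + v n i| ^ p - 2 ^ (p - 1) * |v n i| ^ p) 0
  have hg_le : ∀ n i, g n i ≤ 2 ^ (p - 1) * |u i| ^ p := fun n i =>
    max_le (by linarith [abs_add_rpow_le hp (u i) (v n i)]) (by positivity)
  have hg_nonneg : ∀ n i, 0 ≤ g n i := fun n i => le_max_right _ _
  have hbound : Summable fun i => 2 ^ (p - 1) * |u i| ^ p := Summable.mul_left _ hu
  have hg : Tendsto (fun n => ∑' i, g n i) atTop (𝓝 (∑' i, |u i| ^ p)) := by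
    refine tendsto_tsum_of_dominated_convergence hbound (fun i => ?_)
      (Eventually.of_forall fun n i => ?_)
    · have hcont : Continuous fun t : ℝ =>
          max (|u i + t| ^ p - 2 ^ (p - 1) * |t| ^ p) 0 := by
        have := Real.continuous_rpow_const hp0.le
        fun_prop
      have h := (hcont.tendsto 0).comp (hlim i)
      simpa [Function.comp_def, Real.zero_rpow hp0.ne', g,
        max_eq_left (Real.rpow_nonneg (abs_nonneg (u i)) p)] using h
    · rw [Real.norm_of_nonneg (hg_nonneg n i)]
      exact hg_le n i
  filter_upwards [hg.eventually_lt_const (lt_add_one _)] with n hn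
  have hgs : Summable (g n) := .of_nonneg_of_le (hg_nonneg n) (hg_le n) hbound
  have hvs : Summable fun i => 2 ^ (p - 1) * |v n i| ^ p := Summable.mul_left _ (hv n)
  calc ∑' i, |u i + v n i| ^ p
      ≤ ∑' i, (g n i + 2 ^ (p - 1) * |v n i| ^ p) :=
        Summable.tsum_le_tsum
          (fun i => by linarith [le_max_left (|u i + v n i| ^ p - 2 ^ (p - 1) * |v n i| ^ p) 0])
          (hu.add hp (hv n)) (hgs.add hvs)
    _ = ∑' i, g n i + 2 ^ (p - 1) * ∑' i, |v n i| ^ p := by rw [hgs.tsum_add hvs, tsum_mul_left]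
    _ ≤ ∑' i, |u i| ^ p + (2 ^ (p - 1) * C + 1) := by
        have := mul_le_mul_of_nonneg_left (hC n) (by positivity : (0 : ℝ) ≤ 2 ^ (p - 1))
        linarith

theorem tsum_rpow_le_of_lpNorm_le (hp : 0 < p) {u : ι → ℝ} {K : ℝ} (h : lpNorm p u ≤ K) :
    ∑' i, |u i| ^ p ≤ K ^ p := by
  have h0 : 0 ≤ ∑' i, |u i| ^ p := tsum_nonneg fun _ => by positivity
  have h1 := Real.rpow_le_rpow (Real.rpow_nonneg h0 _) h hp.le
  rwa [← Real.rpow_mul h0, one_div_mul_cancel hp.ne', Real.rpow_one] at h1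

theorem lpNorm_lt_of_tsum_rpow_lt (hp : 0 < p) {u : ι → ℝ} {ε : ℝ} (hε : 0 < ε)
    (h : ∑' i, |u i| ^ p < ε ^ p) : lpNorm p u < ε := by
  have h0 : 0 ≤ ∑' i, |u i| ^ p := tsum_nonneg fun _ => by positivity
  have h1 := Real.rpow_lt_rpow h0 h (one_div_pos.mpr hp)
  rwa [← Real.rpow_mul hε.le, mul_one_div_cancel hp.ne', Real.rpow_one] at h1

theorem memLp'_prod [Finite ι] {κ : Type*} {u : ι × κ → ℝ}
    (hu : ∀ i, MemLp' p (fun k => u (i, k))) : MemLp' p u :=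
  (summable_prod_of_nonneg fun _ => by positivity).mpr ⟨hu, Summable.of_finite⟩

end Summability

section Gradient

variable {G : Type*} [Group G] {p : ℝ}

theorem memLp'_grad_of_closure (hp : 1 ≤ p) {S : Finset G}
    (hgen : Subgroup.closure (S : Set G) = ⊤) {f : G → ℝ} (hf : IsDirichlet S p f) (γ : G) :
    MemLp' p (grad γ f) := by
  have hγ : γ ∈ Subgroup.closure (S : Set G) := hgen ▸ Subgroup.mem_top γ
  induction hγ using Subgroup.closure_induction with
  | mem s hs => exact hf s hs
  | one =>
    convert! memLp'_zero hp using 2 with x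
    simp [grad]
  | mul a b _ _ ha hb =>
    convert! (hb.comp_injective (mul_right_injective a⁻¹)).add hp ha using 2 with x
    simp [grad, mul_assoc]
  | inv a _ ha =>
    convert! (ha.comp_injective (mul_right_injective a)).const_mul (-1) using 2 with x
    simp [grad]

theorem memLp'_sub_conv (hp : 1 ≤ p) {S : Finset G}
    (hgen : Subgroup.closure (S : Set G) = ⊤) {f : G → ℝ} (hf : IsDirichlet S p f)
    {ξ : G → ℝ} (hfin : (Function.support ξ).Finite) (hsum : ∑' γ, ξ γ = 1) :
    MemLp' p (fun x => f x - conv ξ f x) := by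
  have hξ : ∀ γ ∉ hfin.toFinset, ξ γ = 0 := by simp
  rw [tsum_eq_sum hξ] at hsum
  convert! MemLp'.sum hp hfin.toFinset (u := fun γ x => -ξ γ * grad γ f x)
    (fun γ _ => (memLp'_grad_of_closure hp hgen hf γ).const_mul _) using 2 with x
  have hconv : conv ξ f x = ∑ γ ∈ hfin.toFinset, ξ γ * f (γ⁻¹ * x) :=
    tsum_eq_sum fun γ hγ => by rw [hξ γ hγ, zero_mul]
  simp only [grad, neg_mul, mul_sub, Finset.sum_neg_distrib, Finset.sum_sub_distrib,
    ← Finset.sum_mul, hsum, one_mul, hconv]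
  ring

end Gradient

theorem vanishing_criterion_for_reduced_class
    {G : Type*} [Group G] (S : Finset G)
    (hsym : ∀ s ∈ S, s⁻¹ ∈ S) (hgen : Subgroup.closure (S : Set G) = ⊤)
    (p : ℝ) (hp : 1 < p) (f : G → ℝ) (hf : IsDirichlet S p f)
    (ξ : ℕ → G → ℝ) (hfin : ∀ n, (Function.support (ξ n)).Finite)
    (hsum : ∀ n, (∑' γ, ξ n γ) = 1)
    (hptwise : ∀ s ∈ S, ∀ x : G,
      Tendsto (fun n => grad s (conv (ξ n) f) x) atTop (𝓝 0))
    (K : ℝ) (hK : 0 < K)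
    (hbdd : ∀ n, ∀ s ∈ S, MemLp' p (grad s (conv (ξ n) f)) ∧
      lpNorm p (grad s (conv (ξ n) f)) ≤ K)
    (ε : ℝ) (hε : 0 < ε) :
    ∃ h : G → ℝ, MemLp' p h ∧ ∀ s ∈ S, lpNorm p (grad s (fun x => f x - h x)) < ε := by

  have hp0 : 0 < p := by linarith
  set D : (G → ℝ) → S × G → ℝ := fun g z => grad (z.1 : G) g z.2
  set v : ℕ → S × G → ℝ := fun n => D (conv (ξ n) f)
  have hv : ∀ n, MemLp' p (v n) := fun n => memLp'_prod fun s => (hbdd n s s.2).1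
  have hC : ∀ n, ∑' z, |v n z| ^ p ≤ S.card * K ^ p := by
    intro n
    rw [Summable.tsum_prod (hv n), tsum_fintype]
    refine (Finset.sum_le_card_nsmul Finset.univ _ (K ^ p) fun (s : S) _ =>
      tsum_rpow_le_of_lpNorm_le hp0 (hbdd n s s.2).2).trans_eq ?_
    simp
  set M : ℝ := 2 ^ (p - 1) * (S.card * K ^ p) + 1
  have hstep : ∀ N : ℕ, ∃ F : G → ℝ, MemLp' p (fun x => N * f x - F x) ∧ MemLp' p (D F) ∧
      ∑' z, |D F z| ^ p ≤ N * M := by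
    intro N
    induction N with
    | zero =>
      refine ⟨fun _ => 0, ?_, ?_, ?_⟩
      · simpa using memLp'_zero hp.le
      · simpa [D, grad] using memLp'_zero (ι := S × G) hp.le
      · simp [D, grad, Real.zero_rpow hp0.ne']
    | succ N ih =>
      obtain ⟨F, hF, hDF, hle⟩ := ih
      obtain ⟨n, hn⟩ := (eventually_tsum_abs_add_rpow_le hp.le hDF hv hC
        fun z => hptwise z.1 z.1.2 z.2).exists
      have hD : D (fun x => F x + conv (ξ n) f x) = fun z => D F z + v n z := by
        funext z
        simp only [D, v, grad]
        ring
      refine ⟨fun x => F x + conv (ξ n) f x, ?_, ?_, ?_⟩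
      · convert! hF.add hp.le (memLp'_sub_conv hp.le hgen hf (hfin n) (hsum n)) using 2 with x
        push_cast
        ring
      · rw [hD]
        exact hDF.add hp.le (hv n)
      · rw [hD]
        push_cast
        linarith
  have hlim : Tendsto (fun N : ℕ => (N : ℝ) ^ (-(p - 1)) * M) atTop (𝓝 0) := by
    simpa using ((tendsto_rpow_neg_atTop (by linarith : 0 < p - 1)).comp
      tendsto_natCast_atTop_atTop).mul_const M
  obtain ⟨N, hN, hN0⟩ := ((hlim.eventually_lt_const (Real.rpow_pos_of_pos hε p)).and
    (eventually_gt_atTop 0)).exists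
  have hNpos : (0 : ℝ) < N := Nat.cast_pos.mpr hN0
  obtain ⟨F, hF, hDF, hle⟩ := hstep N
  refine ⟨fun x => (N : ℝ)⁻¹ * (N * f x - F x), hF.const_mul _, fun s hs => ?_⟩
  refine lpNorm_lt_of_tsum_rpow_lt hp0 hε (lt_of_le_of_lt ?_ hN)
  have hgrad : ∀ x, |grad s (fun x => f x - (N : ℝ)⁻¹ * (N * f x - F x)) x| ^ p =
      (N : ℝ) ^ (-p) * |D F (⟨s, hs⟩, x)| ^ p := by
    intro x
    have : grad s (fun x => f x - (N : ℝ)⁻¹ * (N * f x - F x)) x =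
        (N : ℝ)⁻¹ * D F (⟨s, hs⟩, x) := by
      simp only [D, grad]
      field_simp
      ring
    rw [this, abs_mul, Real.mul_rpow (abs_nonneg _) (abs_nonneg _), abs_of_pos (inv_pos.mpr hNpos),
      Real.inv_rpow hNpos.le, Real.rpow_neg hNpos.le]
  have hslice : ∑' x, |D F (⟨s, hs⟩, x)| ^ p ≤ ∑' z, |D F z| ^ p :=
    tsum_comp_le_tsum_of_inj hDF (fun _ => by positivity)
      (Prod.mk_right_injective (⟨s, hs⟩ : S))
  calc ∑' x, |grad s (fun x => f x - (N : ℝ)⁻¹ * (N * f x - F x)) x| ^ p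
      = (N : ℝ) ^ (-p) * ∑' x, |D F (⟨s, hs⟩, x)| ^ p := by simp only [hgrad, tsum_mul_left]
    _ ≤ (N : ℝ) ^ (-p) * (N * M) := by gcongr; exact hslice.trans hle
    _ = (N : ℝ) ^ (-(p - 1)) * M := by
      rw [neg_sub, sub_eq_neg_add, Real.rpow_add hNpos, Real.rpow_one, mul_assoc]
end

section
/- Let G be a group with a finite symmetric generating set S, and suppose G has a controlled Følner sequence: there are a constant K > 0 and finite nonempty subsets F_n ⊆ G with diam(F_n) → ∞ and, for every n and every s ∈ S, |F_n Δ sF_n| / |F_n| ≤ K / diam(F_n), where sF_n = {s*g : g ∈ F_n} and diam(F_n) is the diameter of F_n for the Cayley distance d. Then for every real p with 1 < p < ∞, the degree-one reduced ℓ^p-cohomology of (G,S) vanishes: for every p-Dirichlet f : G → ℝ and every ε > 0 there exists h ∈ ℓ^p(G) with ‖∇_s(f − h)‖_{ℓ^p(G)} < ε for every s ∈ S. -/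
open Filter Topology

open Classical in
/-- The diameter of a finite subset of `G` for the Cayley distance. -/
noncomputable def finsetDiam {G : Type*} [Group G] (S : Finset G) (F : Finset G) : ℕ :=
  (F ×ˢ F).sup fun z => wordLength S (z.2 * z.1⁻¹)

open Classical in
/-- The translate `s • F` of a finite set. -/
noncomputable def leftTranslate {G : Type*} [Group G] (s : G) (F : Finset G) : Finset G :=
  F.image (fun g => s * g)

open Classical in
/-- Symmetric difference of two finite sets. -/
noncomputable def finsetSymmDiff {G : Type*} (A B : Finset G) : Finset G :=
  (A \ B) ∪ (B \ A)

open scoped ENNReal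

section WordLength

variable {G : Type*} [Group G] {S : Finset G}

lemma wordLength_prod_le {l : List G} (hl : ∀ x ∈ l, x ∈ S) :
    wordLength S l.prod ≤ l.length :=
  Nat.sInf_le ⟨l, rfl, hl, rfl⟩

lemma exists_list_length_eq_wordLength (hsym : ∀ s ∈ S, s⁻¹ ∈ S)
    (hgen : Subgroup.closure (S : Set G) = ⊤) (g : G) :
    ∃ l : List G, l.length = wordLength S g ∧ (∀ x ∈ l, x ∈ S) ∧ l.prod = g := by
  have hg : g ∈ Submonoid.closure ((S : Set G) ∪ (S : Set G)⁻¹) := by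
    rw [← Subgroup.closure_toSubmonoid, hgen]
    trivial
  obtain ⟨l, hl, hg⟩ := Submonoid.exists_list_of_mem_closure hg
  refine Nat.sInf_mem (s := {n : ℕ | ∃ l : List G, l.length = n ∧ (∀ x ∈ l, x ∈ S) ∧ l.prod = g})
    ⟨l.length, l, rfl, fun x hx => ?_, hg⟩
  rcases hl x hx with h | h
  · exact h
  · simpa using hsym _ h

lemma wordLength_mul_le_of_mem (hsym : ∀ s ∈ S, s⁻¹ ∈ S)
    (hgen : Subgroup.closure (S : Set G) = ⊤) {s : G} (hs : s ∈ S) (g : G) :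
    wordLength S (s * g) ≤ wordLength S g + 1 := by
  obtain ⟨l, hlen, hl, rfl⟩ := exists_list_length_eq_wordLength hsym hgen g
  rw [← hlen, ← List.prod_cons, ← List.length_cons (a := s)]
  refine wordLength_prod_le ?_
  simpa [hs] using hl

/-- Every group element is the endpoint of a geodesic path starting at `1`. -/
lemma exists_geodesic (hsym : ∀ s ∈ S, s⁻¹ ∈ S)
    (hgen : Subgroup.closure (S : Set G) = ⊤) (g : G) :
    ∃ γ : ℕ → G, γ 0 = 1 ∧ γ (wordLength S g) = g ∧
      (∀ i < wordLength S g, (γ i)⁻¹ * γ (i + 1) ∈ S) ∧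
      Set.InjOn γ (Finset.range (wordLength S g)) := by
  obtain ⟨l, hlen, hl, hg⟩ := exists_list_length_eq_wordLength hsym hgen g
  have key : ∀ i j, i < j → j < l.length → (l.take i).prod ≠ (l.take j).prod := by
    intro i j hij hj h
    have h1 : (l.take i ++ l.drop j).prod = g := by
      rw [List.prod_append, h, ← List.prod_append, List.take_append_drop, hg]
    have h2 := wordLength_prod_le (S := S) (l := l.take i ++ l.drop j) (by
      intro x hx
      rcases List.mem_append.1 hx with hx | hx
      · exact hl x (List.mem_of_mem_take hx)
      · exact hl x (List.mem_of_mem_drop hx))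
    rw [h1, ← hlen, List.length_append, List.length_take, List.length_drop] at h2
    omega
  refine ⟨fun i => (l.take i).prod, by simp, ?_, fun i hi => ?_, fun i hi j hj h => ?_⟩
  · simp [← hlen, hg]
  · rw [← hlen] at hi
    simp only [List.take_succ_eq_append_getElem hi, List.prod_append, List.prod_singleton,
      inv_mul_cancel_left]
    exact hl _ (List.getElem_mem hi)
  · rw [← hlen] at hi hj
    simp only [Finset.coe_range, Set.mem_Iio] at hi hj
    rcases lt_trichotomy i j with hij | hij | hij
    · exact absurd h (key i j hij hj)
    · exact hij
    · exact absurd h.symm (key j i hij hi)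

end WordLength

open Classical in
/-- A sum of `n` point masses of size at most `U` at distinct points has `ℓ^q`-norm at most
`U * n^(1/q)`. -/
lemma norm_sum_lp_single_le {α : Type*} {q : ℝ≥0∞} (hq : 0 < q.toReal) {n : ℕ} {y : ℕ → α}
    (hy : Set.InjOn y (Finset.range n)) (a : ℕ → ℝ) {U : ℝ} (hU : 0 ≤ U)
    (ha : ∀ i < n, |a i| ≤ U) :
    ‖∑ i ∈ Finset.range n, lp.single (E := fun _ : α => ℝ) q (y i) (a i)‖ ≤
      U * (n : ℝ) ^ (1 / q.toReal) := by
  set b : α → ℝ := fun z => a (Function.invFunOn y (Finset.range n) z) with hb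
  have hby : ∀ i ∈ Finset.range n, b (y i) = a i := fun i hi => by
    simp only [hb]
    rw [hy.leftInvOn_invFunOn hi]
  have h1 : ∑ i ∈ Finset.range n, lp.single (E := fun _ : α => ℝ) q (y i) (a i) =
      ∑ z ∈ (Finset.range n).image y, lp.single (E := fun _ : α => ℝ) q z (b z) := by
    rw [Finset.sum_image hy]
    exact Finset.sum_congr rfl fun i hi => by rw [hby i hi]
  have h2 : ‖∑ z ∈ (Finset.range n).image y, lp.single (E := fun _ : α => ℝ) q z (b z)‖ ^
      q.toReal ≤ (U * (n : ℝ) ^ (1 / q.toReal)) ^ q.toReal := by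
    rw [lp.norm_sum_single hq, Finset.sum_image hy, Real.mul_rpow hU (by positivity),
      ← Real.rpow_mul (by positivity), one_div_mul_cancel hq.ne', Real.rpow_one]
    calc ∑ i ∈ Finset.range n, ‖b (y i)‖ ^ q.toReal
        ≤ ∑ i ∈ Finset.range n, U ^ q.toReal := by
          refine Finset.sum_le_sum fun i hi => ?_
          rw [hby i hi]
          exact Real.rpow_le_rpow (norm_nonneg _) (ha i (Finset.mem_range.1 hi)) hq.le
      _ = U ^ q.toReal * n := by simp [mul_comm]
  rw [h1]
  have h3 : 0 ≤ U * (n : ℝ) ^ (1 / q.toReal) := by positivity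
  exact (Real.rpow_le_rpow_iff (lp.norm_nonneg' _) h3 hq).1 h2

section Translation

variable {G : Type*} [Group G] {q : ℝ≥0∞}

/-- Left translation on `ℓ^q(G)`. -/
def lpTranslate (hq : 0 < q.toReal) (g : G) (v : lp (fun _ : G => ℝ) q) :
    lp (fun _ : G => ℝ) q :=
  ⟨fun x => v (g⁻¹ * x), (memℓp_gen_iff hq).2
    ((Equiv.mulLeft g⁻¹).summable_iff.2 ((memℓp_gen_iff hq).1 (lp.memℓp v)))⟩

@[simp]
lemma lpTranslate_apply (hq : 0 < q.toReal) (g : G) (v : lp (fun _ : G => ℝ) q) (x : G) :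
    lpTranslate hq g v x = v (g⁻¹ * x) := rfl

lemma norm_lpTranslate (hq : 0 < q.toReal) (g : G) (v : lp (fun _ : G => ℝ) q) :
    ‖lpTranslate hq g v‖ = ‖v‖ := by
  rw [lp.norm_eq_tsum_rpow hq, lp.norm_eq_tsum_rpow hq]
  congr 1
  exact (Equiv.mulLeft g⁻¹).tsum_eq fun x => ‖v x‖ ^ q.toReal

end Translation

section Cocycle

variable {G : Type*} [Group G] {S : Finset G} {q : ℝ≥0∞} {f : G → ℝ}

lemma memℓp_grad (hq : 0 < q.toReal) (hgen : Subgroup.closure (S : Set G) = ⊤)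
    (hf : ∀ s ∈ S, Memℓp (grad s f) q) (g : G) : Memℓp (grad g f) q := by
  have shift : ∀ (g : G) (v : G → ℝ), Memℓp v q → Memℓp (fun x => v (g⁻¹ * x)) q :=
    fun g v hv => (lpTranslate hq g ⟨v, hv⟩).2
  have hg : g ∈ Subgroup.closure (S : Set G) := hgen ▸ Subgroup.mem_top g
  induction hg using Subgroup.closure_induction with
  | mem s hs => exact hf s hs
  | one =>
    convert (zero_memℓp : Memℓp (0 : G → ℝ) q) using 1
    ext x
    simp [grad]
  | mul g h _ _ ihg ihh =>
    convert (shift g _ ihh).add ihg using 1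
    ext x
    simp [grad, mul_assoc]
  | inv g _ ih =>
    convert (shift g⁻¹ _ ih).neg using 1
    ext x
    simp [grad]

open Classical in
/-- The cocycle `g ↦ λ_g f - f` of a `q`-Dirichlet function grows sublinearly. -/
lemma exists_forall_norm_cocycle_le [Fact (1 ≤ q)] (hq1 : 1 < q.toReal) (hq : q ≠ ∞)
    (hsym : ∀ s ∈ S, s⁻¹ ∈ S) (hgen : Subgroup.closure (S : Set G) = ⊤)
    (c : G → lp (fun _ : G => ℝ) q) (hc : ∀ g x, c g x = grad g f x) {η : ℝ} (hη : 0 < η) :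
    ∃ N : ℕ, ∀ n ≥ N, ∀ g, wordLength S g ≤ n → ‖c g‖ ≤ η * n := by
  have hq0 : 0 < q.toReal := by linarith
  obtain ⟨T, hT⟩ : ∃ T : Finset G, ∀ s ∈ S,
      ‖c s - ∑ t ∈ T, lp.single (E := fun _ : G => ℝ) q t (c s t)‖ < η / 2 := by
    have : ∀ᶠ T : Finset G in atTop, ∀ s ∈ S,
        ‖c s - ∑ t ∈ T, lp.single (E := fun _ : G => ℝ) q t (c s t)‖ < η / 2 := by
      rw [Filter.eventually_all_finset]
      intro s _
      have := (Metric.tendsto_nhds.1 (lp.hasSum_single hq (c s))) (η / 2) (by positivity)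
      filter_upwards [this] with T hT
      rwa [dist_comm, dist_eq_norm] at hT
    exact this.exists
  set U : ℝ := ∑ s ∈ S, ‖c s‖ with hUdef
  have hU : 0 ≤ U := Finset.sum_nonneg fun _ _ => norm_nonneg _
  have hUc : ∀ s ∈ S, ∀ x, |c s x| ≤ U := fun s hs x =>
    (lp.norm_apply_le_norm (by rintro rfl; simp at hq0) (c s) x).trans
      (Finset.single_le_sum (f := fun s => ‖c s‖) (fun _ _ => norm_nonneg _) hs)
  have growth : ∀ g, ‖c g‖ ≤ wordLength S g * (η / 2) +
      T.card * (U * (wordLength S g : ℝ) ^ (1 / q.toReal)) := by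
    intro g
    obtain ⟨γ, h0, hn, hstep, hinj⟩ := exists_geodesic hsym hgen g
    generalize wordLength S g = n at *
    set s : ℕ → G := fun i => (γ i)⁻¹ * γ (i + 1) with hs
    have hsum : c g = ∑ i ∈ Finset.range n, lpTranslate hq0 (γ i)
          (c (s i) - ∑ t ∈ T, lp.single (E := fun _ : G => ℝ) q t (c (s i) t)) +
        ∑ t ∈ T, ∑ i ∈ Finset.range n,
          lp.single (E := fun _ : G => ℝ) q (γ i * t) (c (s i) t) := by
      rw [Finset.sum_comm, ← Finset.sum_add_distrib]
      have hterm : ∀ i, lpTranslate hq0 (γ i)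
          (c (s i) - ∑ t ∈ T, lp.single (E := fun _ : G => ℝ) q t (c (s i) t)) +
          ∑ t ∈ T, lp.single (E := fun _ : G => ℝ) q (γ i * t) (c (s i) t) =
          c (γ (i + 1)) - c (γ i) := by
        intro i
        ext x
        have hsing : ∀ t, lp.single (E := fun _ : G => ℝ) q t (c (s i) t) ((γ i)⁻¹ * x) =
            lp.single (E := fun _ : G => ℝ) q (γ i * t) (c (s i) t) x := by
          intro t
          simp only [lp.single_apply, Pi.single_apply, inv_mul_eq_iff_eq_mul]
        simp only [lp.coeFn_add, lp.coeFn_sub, lp.coeFn_sum, Pi.add_apply, Pi.sub_apply,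
          Finset.sum_apply, lpTranslate_apply, hsing, sub_add_cancel]
        simp [hc, hs, grad, mul_assoc]
      rw [Finset.sum_congr rfl fun i _ => hterm i, Finset.sum_range_sub (fun i => c (γ i)) n, hn, h0]
      have : c 1 = 0 := by
        ext x
        simp [hc, grad]
      rw [this, sub_zero]
    rw [hsum]
    refine (norm_add_le _ _).trans (add_le_add ?_ ?_)
    · refine (norm_sum_le_of_le (f := fun i => lpTranslate hq0 (γ i) _) _
        (n := fun _ => η / 2) fun i hi => ?_).trans (by simp)
      rw [norm_lpTranslate]
      exact (hT _ (hstep i (Finset.mem_range.1 hi))).le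
    · refine (norm_sum_le_of_le _ (n := fun _ => U * (n : ℝ) ^ (1 / q.toReal))
        fun t _ => ?_).trans (by simp)
      exact norm_sum_lp_single_le hq0 (y := fun i => γ i * t)
        (fun i hi j hj h => hinj hi hj (mul_right_cancel h)) _ hU
        fun i hi => hUc _ (hstep i hi) t
  have hlim : Tendsto (fun n : ℕ => T.card * U * (n : ℝ) ^ (-(1 - 1 / q.toReal))) atTop (𝓝 0) := by
    have h1 : 0 < 1 - 1 / q.toReal := by
      rw [sub_pos, div_lt_one hq0]
      exact hq1
    simpa using ((tendsto_rpow_neg_atTop h1).comp tendsto_natCast_atTop_atTop).const_mul (T.card * U)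
  obtain ⟨N, hN⟩ := eventually_atTop.1
    ((hlim.eventually_lt_const (show (0 : ℝ) < η / 2 by positivity)).and (eventually_ge_atTop 1))
  refine ⟨N, fun n hn g hg => ?_⟩
  obtain ⟨hlt, hn1⟩ := hN n hn
  have hn0 : (0 : ℝ) < n := by exact_mod_cast hn1
  have hg' : (wordLength S g : ℝ) ≤ n := by exact_mod_cast hg
  have hpow : (n : ℝ) ^ (1 / q.toReal) = (n : ℝ) ^ (-(1 - 1 / q.toReal)) * n := by
    rw [← Real.rpow_add_one hn0.ne']
    congr 1
    ring
  calc ‖c g‖ ≤ wordLength S g * (η / 2) +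
        T.card * (U * (wordLength S g : ℝ) ^ (1 / q.toReal)) := growth g
    _ ≤ n * (η / 2) + T.card * (U * (n : ℝ) ^ (1 / q.toReal)) := by gcongr
    _ = n * (η / 2) + (T.card * U * (n : ℝ) ^ (-(1 - 1 / q.toReal))) * n := by rw [hpow]; ring
    _ ≤ n * (η / 2) + η / 2 * n := by gcongr
    _ = η * n := by ring

end Cocycle

theorem vanishing_of_reduced_lp_cohomology_of_controlled_Folner
    {G : Type*} [Group G] (S : Finset G)
    (hsym : ∀ s ∈ S, s⁻¹ ∈ S) (hgen : Subgroup.closure (S : Set G) = ⊤)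
    (K : ℝ) (hK : 0 < K) (F : ℕ → Finset G) (hne : ∀ n, (F n).Nonempty)
    (hdiam : Tendsto (fun n => finsetDiam S (F n)) atTop atTop)
    (hctrl : ∀ n, ∀ s ∈ S,
      ((finsetSymmDiff (F n) (leftTranslate s (F n))).card : ℝ) / (F n).card ≤
        K / (finsetDiam S (F n) : ℝ))
    (p : ℝ) (hp : 1 < p) (f : G → ℝ) (hf : IsDirichlet S p f) (ε : ℝ) (hε : 0 < ε) :
    ∃ h : G → ℝ, MemLp' p h ∧ ∀ s ∈ S, lpNorm p (grad s (fun x => f x - h x)) < ε := by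
  classical
  have hp0 : 0 < p := by linarith
  set q : ℝ≥0∞ := ENNReal.ofReal p with hqdef
  have hqp : q.toReal = p := ENNReal.toReal_ofReal hp0.le
  have hq0 : 0 < q.toReal := hqp ▸ hp0
  have : Fact (1 ≤ q) := ⟨ENNReal.one_le_ofReal.2 hp.le⟩
  have hmem : ∀ v : G → ℝ, MemLp' p v ↔ Memℓp v q := fun v => by
    rw [memℓp_gen_iff hq0, hqp]
    rfl
  have hnorm : ∀ v : lp (fun _ : G => ℝ) q, lpNorm p v = ‖v‖ := fun v => by
    rw [lp.norm_eq_tsum_rpow hq0, hqp]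
    rfl
  have hcmem := memℓp_grad hq0 hgen fun s hs => (hmem _).1 (hf s hs)
  set c : G → lp (fun _ : G => ℝ) q := fun g => ⟨grad g f, hcmem g⟩ with hcdef
  have hc : ∀ g x, c g x = f (g⁻¹ * x) - f x := fun _ _ => rfl
  set η : ℝ := ε / (3 * K) with hη
  obtain ⟨N, hN⟩ := exists_forall_norm_cocycle_le (S := S) (hqp.symm ▸ hp : 1 < q.toReal)
    ENNReal.ofReal_ne_top hsym hgen c (fun _ _ => rfl) (show 0 < η by positivity)
  obtain ⟨n, hnN, hn1⟩ := ((hdiam.eventually_ge_atTop N).and (hdiam.eventually_ge_atTop 1)).exists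
  set D := finsetDiam S (F n) with hD
  have hD1 : (1 : ℝ) ≤ D := by exact_mod_cast hn1
  obtain ⟨g₀, hg₀⟩ := hne n
  have hcard : (0 : ℝ) < (F n).card := by exact_mod_cast (hne n).card_pos
  have hdist : ∀ g ∈ F n, wordLength S (g * g₀⁻¹) ≤ D := fun g hg =>
    Finset.le_sup (f := fun z : G × G => wordLength S (z.2 * z.1⁻¹))
      (Finset.mk_mem_product hg₀ hg)
  set v : lp (fun _ : G => ℝ) q := -(((F n).card : ℝ)⁻¹ • ∑ g ∈ F n, c (g * g₀⁻¹)) with hv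
  refine ⟨v, (hmem _).2 (lp.memℓp v), fun s hs => ?_⟩
  set A := leftTranslate s (F n) with hA
  have hgrad : grad s (fun x => f x - v x) =
      (((F n).card : ℝ)⁻¹ • (∑ g ∈ A \ F n, c (g * g₀⁻¹) -
        ∑ g ∈ F n \ A, c (g * g₀⁻¹)) : lp (fun _ : G => ℝ) q) := by
    rw [Finset.sum_sdiff_sub_sum_sdiff, hA, leftTranslate,
      Finset.sum_image (mul_right_injective s).injOn]
    ext x
    simp only [grad, hv, lp.coeFn_neg, lp.coeFn_smul, lp.coeFn_sub, lp.coeFn_sum, Pi.neg_apply,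
      Pi.smul_apply, Pi.sub_apply, Finset.sum_apply, smul_eq_mul, hc, Finset.sum_sub_distrib,
      Finset.sum_const, nsmul_eq_mul, mul_inv_rev, mul_assoc]
    field_simp
    ring
  rw [hgrad, hnorm, norm_smul, norm_inv, Real.norm_natCast]
  have hbound : ∀ g ∈ A ∪ F n, ‖c (g * g₀⁻¹)‖ ≤ η * (D + 1 : ℕ) := by
    intro g hg
    refine hN (D + 1) (by omega) _ ?_
    rcases Finset.mem_union.1 hg with hg | hg
    · obtain ⟨g', hg', rfl⟩ := Finset.mem_image.1 hg
      rw [mul_assoc]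
      exact (wordLength_mul_le_of_mem hsym hgen hs _).trans (Nat.add_le_add_right (hdist g' hg') 1)
    · exact (hdist g hg).trans (Nat.le_succ D)
  have hsymm : ((finsetSymmDiff (F n) A).card : ℝ) = (A \ F n).card + (F n \ A).card := by
    rw [finsetSymmDiff, Finset.card_union_of_disjoint disjoint_sdiff_sdiff]
    push_cast
    ring
  have hsum : ‖∑ g ∈ A \ F n, c (g * g₀⁻¹) - ∑ g ∈ F n \ A, c (g * g₀⁻¹)‖ ≤
      (finsetSymmDiff (F n) A).card * (η * (D + 1 : ℕ)) := by
    rw [hsymm, add_mul]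
    refine (norm_sub_le _ _).trans (add_le_add ?_ ?_)
    · refine (norm_sum_le_of_le _ (n := fun _ => η * (D + 1 : ℕ)) fun g hg => hbound g ?_).trans
        (by simp)
      exact Finset.mem_union_left _ (Finset.sdiff_subset hg)
    · refine (norm_sum_le_of_le _ (n := fun _ => η * (D + 1 : ℕ)) fun g hg => hbound g ?_).trans
        (by simp)
      exact Finset.mem_union_right _ (Finset.sdiff_subset hg)
  calc ((F n).card : ℝ)⁻¹ * ‖∑ g ∈ A \ F n, c (g * g₀⁻¹) - ∑ g ∈ F n \ A, c (g * g₀⁻¹)‖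
      ≤ ((F n).card : ℝ)⁻¹ * ((finsetSymmDiff (F n) A).card * (η * (D + 1 : ℕ))) := by gcongr
    _ = (finsetSymmDiff (F n) A).card / (F n).card * (η * (D + 1 : ℕ)) := by ring
    _ ≤ K / D * (η * (D + 1 : ℕ)) := mul_le_mul_of_nonneg_right (hctrl n s hs) (by positivity)
    _ ≤ K / D * (η * (2 * D)) := by gcongr; push_cast; linarith
    _ = 2 / 3 * ε := by rw [hη]; field_simp
    _ < ε := by linarith
end
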